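/- For every n ≥ 1 and every integer k, the number of Dyck paths of length n with area k equals the number of non-crossing permutations of {1,…,n} with exactly k inversions; equivalently, Σ_{w ∈ D_n} q^{area(w)} = Σ_{σ ∈ NC(n)} q^{inv(σ)} (where inv(σ) is the Coxeter length of σ in the symmetric group). -/

import Mathlib

open scoped Classical

namespace Stmt

/-- Number of north steps (`true`) among the first `k` steps of the path `w`. -/
def countN {m : ℕ} (w : Fin m → Bool) (k : ℕ) : ℕ :=
  (Finset.univ.filter (fun t : Fin m => (t : ℕ) < k ∧ w t = true)).card

/-- Number of east steps (`false`) among the first `k` steps of the path `w`. -/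
def countE {m : ℕ} (w : Fin m → Bool) (k : ℕ) : ℕ :=
  (Finset.univ.filter (fun t : Fin m => (t : ℕ) < k ∧ w t = false)).card

/-- A Dyck path of length `n`: `n` north and `n` east steps, every prefix has
at least as many north as east steps. -/
def IsDyckA (n : ℕ) (w : Fin (2 * n) → Bool) : Prop :=
  countN w (2 * n) = n ∧ ∀ k : ℕ, countE w k ≤ countN w k

/-- A Dyck path of type `B_n`: `2n` steps, every prefix has at least as many
north as east steps. -/
def IsDyckB (n : ℕ) (w : Fin (2 * n) → Bool) : Prop :=
  ∀ k : ℕ, countE w k ≤ countN w k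

/-- The unit cell `[i-1,i] × [j-1,j]` lies below the lattice path `w`:
at some time the path has `x`-coordinate `< i` and `y`-coordinate `≥ j`. -/
def CellBelow {m : ℕ} (w : Fin m → Bool) (i j : ℕ) : Prop :=
  ∃ k : ℕ, countE w k < i ∧ j ≤ countN w k

/-- Area of a (type `A`) Dyck path: number of cells `b_{i,j}` with `i < j`
lying below the path. -/
noncomputable def areaA {m : ℕ} (w : Fin m → Bool) : ℕ :=
  {p : ℕ × ℕ | 1 ≤ p.1 ∧ p.1 < p.2 ∧ CellBelow w p.1 p.2}.ncard

/-- Area of a type `B_n` Dyck path: number of cells `b_{i,j}` with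
`1 ≤ i < j ≤ 2n+1-i` lying below the path. -/
noncomputable def areaB (n : ℕ) (w : Fin (2 * n) → Bool) : ℕ :=
  {p : ℕ × ℕ | 1 ≤ p.1 ∧ p.1 < p.2 ∧ p.2 ≤ 2 * n + 1 - p.1 ∧
    CellBelow w p.1 p.2}.ncard

/-- Descent set of a path, 1-indexed: positions `i` with `w_i = E`, `w_{i+1} = N`. -/
def pathDes {m : ℕ} (w : Fin m → Bool) : Finset ℕ :=
  (Finset.Ioo 0 m).filter (fun i =>
    ∃ h : i < m, w ⟨i - 1, Nat.lt_of_le_of_lt (Nat.sub_le i 1) h⟩ = false ∧ w ⟨i, h⟩ = true)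

def desPath {m : ℕ} (w : Fin m → Bool) : ℕ := (pathDes w).card

/-- Major index of a Dyck path of length `n`: `maj(w) = ∑_{i ∈ Des(w)} (2n - i)`. -/
def majA (n : ℕ) (w : Fin (2 * n) → Bool) : ℕ :=
  ∑ i ∈ pathDes w, (2 * n - i)

/-- Number of east steps of a path. -/
def negPath {m : ℕ} (w : Fin m → Bool) : ℕ :=
  (Finset.univ.filter (fun t : Fin m => w t = false)).card

/-- Type `B` major index: `maj(w) = 2 ⬝ (neg(w) + ∑_{i ∈ Des(w)} (2n - i))`. -/
def majB (n : ℕ) (w : Fin (2 * n) → Bool) : ℕ :=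
  2 * (negPath w + ∑ i ∈ pathDes w, (2 * n - i))

/-- Number of inversions of a permutation of `{1,…,n}`. -/
def invP {n : ℕ} (σ : Equiv.Perm (Fin n)) : ℕ :=
  (Finset.univ.filter (fun p : Fin n × Fin n => p.1 < p.2 ∧ σ p.2 < σ p.1)).card

/-- Descent set of a permutation, as 1-indexed positions in `{1,…,n-1}`. -/
def permDes {n : ℕ} (σ : Equiv.Perm (Fin n)) : Finset ℕ :=
  (Finset.Ico 1 n).filter (fun i =>
    ∃ h : i < n, σ ⟨i, h⟩ < σ ⟨i - 1, Nat.lt_of_le_of_lt (Nat.sub_le i 1) h⟩)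

def desP {n : ℕ} (σ : Equiv.Perm (Fin n)) : ℕ := (permDes σ).card

def majP {n : ℕ} (σ : Equiv.Perm (Fin n)) : ℕ := ∑ i ∈ permDes σ, i

def imajP {n : ℕ} (σ : Equiv.Perm (Fin n)) : ℕ := majP σ⁻¹

/-- Every orbit of `σ` is an increasing cycle: each element is mapped to the
next larger element of its orbit, the largest being mapped to the smallest. -/
def IncCycles {n : ℕ} (σ : Equiv.Perm (Fin n)) : Prop :=
  ∀ x : Fin n,
    ((∃ y, σ.SameCycle x y ∧ x < y) →
      x < σ x ∧ ∀ y, σ.SameCycle x y → x < y → σ x ≤ y) ∧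
    ((∀ y, σ.SameCycle x y → y ≤ x) → ∀ y, σ.SameCycle x y → σ x ≤ y)

/-- No two distinct orbits of `σ` cross. -/
def NoCrossing {n : ℕ} (σ : Equiv.Perm (Fin n)) : Prop :=
  ¬ ∃ a b c d : Fin n, a < b ∧ b < c ∧ c < d ∧
      σ.SameCycle a c ∧ σ.SameCycle b d ∧ ¬σ.SameCycle a b

/-- Non-crossing permutations of `{1,…,n}`. -/
def IsNC {n : ℕ} (σ : Equiv.Perm (Fin n)) : Prop := IncCycles σ ∧ NoCrossing σ

/-- A local form of non-crossing: forward arcs `(x, σ x)` and backward arcs `[σ y, y]` are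
preserved by `σ`. -/
def PreservesArcs {n : ℕ} (σ : Equiv.Perm (Fin n)) : Prop :=
  (∀ x y, x < y → y < σ x → x < σ y ∧ σ y < σ x) ∧
    ∀ x y, σ y ≤ x → x < y → σ y ≤ σ x ∧ σ x ≤ y

theorem mem_of_sameCycle {α : Type*} [Finite α] {σ : Equiv.Perm α} {S : Set α}
    (hS : ∀ x ∈ S, σ x ∈ S) {x y : α} (hx : x ∈ S) (hxy : σ.SameCycle x y) : y ∈ S := by
  obtain ⟨i, -, rfl⟩ := hxy.exists_pow_eq'
  induction i with
  | zero => simpa using hx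
  | succ i ih =>
    rw [pow_succ', Equiv.Perm.mul_apply]
    exact hS _ (ih ⟨i, by simp⟩)

theorem inv_apply_apply {α : Type*} (σ : Equiv.Perm α) (x : α) : σ⁻¹ (σ x) = x :=
  σ.symm_apply_apply x

theorem sameCycle_apply {α : Type*} (σ : Equiv.Perm α) (x : α) : σ.SameCycle x (σ x) := ⟨1, by simp⟩

theorem IsNC.preservesArcs {n : ℕ} {σ : Equiv.Perm (Fin n)} (h : IsNC σ) : PreservesArcs σ := by
  obtain ⟨hinc, hcr⟩ := h
  refine ⟨fun x y hxy hy => ?_, fun x y hyx hxy => ?_⟩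
  · have hne : ¬ σ.SameCycle x y := fun hs =>
      absurd (((hinc x).1 ⟨y, hs, hxy⟩).2 y hs hxy) (not_le.2 hy)
    have hx' := sameCycle_apply σ x
    have hy' := sameCycle_apply σ y
    have h1 : σ y ≠ x := fun he => hne (he ▸ hy').symm
    have h2 : σ y ≠ σ x := fun he => hxy.ne' (σ.injective he)
    constructor
    · by_contra hc
      exact hcr ⟨σ y, x, y, σ x, lt_of_le_of_ne (not_lt.1 hc) h1, hxy, hy, hy'.symm, hx',
        fun hs => hne (hy'.trans hs).symm⟩
    · by_contra hc
      exact hcr ⟨x, y, σ x, σ y, hxy, hy, lt_of_le_of_ne (not_lt.1 hc) h2.symm, hx', hy', hne⟩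
  · have hmax : ∀ z, σ.SameCycle y z → z ≤ y := by
      intro z hz
      by_contra hc
      exact absurd ((hinc y).1 ⟨z, hz, not_le.1 hc⟩).1 (by order)
    have hmin := (hinc y).2 hmax
    have hx' := sameCycle_apply σ x
    have hy' := sameCycle_apply σ y
    by_cases hs : σ.SameCycle y x
    · exact ⟨hmin _ (hs.trans hx'), hmax _ (hs.trans hx')⟩
    · have h1 : σ y ≠ x := fun he => hs (he ▸ hy')
      have hlt := lt_of_le_of_ne hyx h1
      constructor
      · by_contra hc
        exact hcr ⟨σ x, σ y, x, y, not_le.1 hc, hlt, hxy, hx'.symm, hy'.symm,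
          fun hs' => hs ((hx'.trans hs').trans hy'.symm).symm⟩
      · by_contra hc
        exact hcr ⟨σ y, x, y, σ x, hlt, hxy, not_le.1 hc, hy'.symm, hx',
          fun hs' => hs (hy'.trans hs')⟩

theorem PreservesArcs.incCycles {n : ℕ} {σ : Equiv.Perm (Fin n)} (h : PreservesArcs σ) :
    IncCycles σ := by
  obtain ⟨hfwd, hbwd⟩ := h
  have hback : ∀ x y, σ x ≤ x → σ.SameCycle x y → y ∈ Set.Icc (σ x) x := by
    intro x y hx hs
    refine mem_of_sameCycle ?_ (Set.mem_Icc.2 ⟨hx, le_rfl⟩) hs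
    rintro z ⟨hz1, hz2⟩
    rcases hz2.eq_or_lt with rfl | hlt
    · exact ⟨le_rfl, hx⟩
    · exact hbwd z x hz1 hlt
  refine fun x => ⟨?_, fun hmax y hs => (hback x y (hmax _ (sameCycle_apply σ x)) hs).1⟩
  rintro ⟨y, hs, hxy⟩
  refine ⟨?_, fun z hz hxz => ?_⟩
  · by_contra hc
    exact absurd (hback x y (not_lt.1 hc) hs).2 (not_le.2 hxy)
  · by_contra hc
    exact lt_irrefl x (mem_of_sameCycle (S := Set.Ioo x (σ x)) (fun w hw => hfwd x w hw.1 hw.2)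
      ⟨hxz, not_le.1 hc⟩ hz.symm).1

theorem PreservesArcs.noCrossing {n : ℕ} {σ : Equiv.Perm (Fin n)} (h : PreservesArcs σ) :
    NoCrossing σ := by
  rintro ⟨a, b, c, d, hab, hbc, hcd, hac, hbd, hn⟩
  obtain ⟨x, hx, hxmax⟩ := Finset.exists_max_image
    (Finset.univ.filter fun z => σ.SameCycle a z ∧ z < b) id
    ⟨a, by simpa using ⟨Equiv.Perm.SameCycle.refl _ _, hab⟩⟩
  simp only [Finset.mem_filter, Finset.mem_univ, true_and, id] at hx hxmax
  obtain ⟨hlt, hnext⟩ := (h.incCycles x).1 ⟨c, hx.1.symm.trans hac, hx.2.trans hbc⟩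
  have hle := hnext c (hx.1.symm.trans hac) (hx.2.trans hbc)
  have hax := hx.1.trans (sameCycle_apply σ x)
  have hb : b < σ x := by
    refine lt_of_le_of_ne ?_ fun he => hn (he ▸ hax)
    by_contra hc
    exact absurd (hxmax _ ⟨hax, not_le.1 hc⟩) (not_le.2 hlt)
  have hd := mem_of_sameCycle (S := Set.Ioo x (σ x)) (fun w hw => h.1 x w hw.1 hw.2)
    ⟨hx.2, hb⟩ hbd
  exact absurd hd.2 (by order)

theorem isNC_iff_preservesArcs {n : ℕ} {σ : Equiv.Perm (Fin n)} : IsNC σ ↔ PreservesArcs σ :=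
  ⟨IsNC.preservesArcs, fun h => ⟨h.incCycles, h.noCrossing⟩⟩

/-- The number of forward arcs of `σ` reaching over the gap between `v - 1` and `v`. -/
def gapArcs {n : ℕ} (σ : Equiv.Perm (Fin n)) (v : ℕ) : ℕ :=
  (Finset.univ.filter fun a : Fin n => (a : ℕ) < v ∧ v ≤ (σ a : ℕ)).card

/-- The number of forward arcs of `σ` passing strictly over `v`. -/
def vertexArcs {n : ℕ} (σ : Equiv.Perm (Fin n)) (v : ℕ) : ℕ :=
  (Finset.univ.filter fun a : Fin n => (a : ℕ) < v ∧ v < (σ a : ℕ)).card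

theorem card_filter_eq_and {α : Type*} [Fintype α] (a : α) (p : Prop)
    [DecidablePred fun x => x = a ∧ p] [Decidable p] :
    (Finset.univ.filter fun x : α => x = a ∧ p).card = if p then 1 else 0 := by
  split_ifs with h
  · rw [Finset.card_eq_one]
    exact ⟨a, by ext; simp [h]⟩
  · simp [h]

theorem gapArcs_eq {n : ℕ} (σ : Equiv.Perm (Fin n)) (v : Fin n) :
    gapArcs σ v = vertexArcs σ v + if σ⁻¹ v < v then 1 else 0 := by
  have h : (Finset.univ.filter fun a : Fin n => (a : ℕ) < v ∧ (v : ℕ) ≤ σ a) =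
      (Finset.univ.filter fun a : Fin n => (a : ℕ) < v ∧ (v : ℕ) < σ a) ∪
        Finset.univ.filter (fun a : Fin n => a = σ⁻¹ v ∧ σ⁻¹ v < v) := by
    ext a
    simp only [Finset.mem_union, Finset.mem_filter, Finset.mem_univ, true_and,
      Equiv.Perm.eq_inv_iff_eq]
    constructor
    · rintro ⟨h1, h2⟩
      rcases h2.lt_or_eq with h | h
      · exact .inl ⟨h1, h⟩
      · have : σ a = v := Fin.ext h.symm
        exact .inr ⟨this, by simpa [← this] using h1⟩
    · rintro (⟨h1, h2⟩ | ⟨rfl, h2⟩)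
      · exact ⟨h1, h2.le⟩
      · exact ⟨by simpa using h2, le_rfl⟩
  rw [gapArcs, h, Finset.card_union_of_disjoint]
  · congr 1
    exact card_filter_eq_and _ _
  · rw [Finset.disjoint_filter]
    rintro a - ⟨-, h1⟩ ⟨rfl, -⟩
    simp at h1

theorem gapArcs_succ {n : ℕ} (σ : Equiv.Perm (Fin n)) (v : Fin n) :
    gapArcs σ (v + 1) = vertexArcs σ v + if v < σ v then 1 else 0 := by
  have h : (Finset.univ.filter fun a : Fin n => (a : ℕ) < v + 1 ∧ (v : ℕ) + 1 ≤ σ a) =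
      (Finset.univ.filter fun a : Fin n => (a : ℕ) < v ∧ (v : ℕ) < σ a) ∪
        Finset.univ.filter (fun a : Fin n => a = v ∧ v < σ v) := by
    ext a
    simp only [Finset.mem_union, Finset.mem_filter, Finset.mem_univ, true_and]
    constructor
    · rintro ⟨h1, h2⟩
      rcases (Nat.lt_succ_iff.1 h1).lt_or_eq with h | h
      · exact .inl ⟨h, h2⟩
      · obtain rfl := Fin.ext h
        exact .inr ⟨rfl, h2⟩
    · rintro (⟨h1, h2⟩ | ⟨rfl, h2⟩)
      · exact ⟨by omega, h2⟩
      · exact ⟨by omega, h2⟩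
  rw [gapArcs, h, Finset.card_union_of_disjoint]
  · congr 1
    exact card_filter_eq_and _ _
  · rw [Finset.disjoint_filter]
    rintro a - ⟨h1, -⟩ ⟨rfl, -⟩
    simp at h1

theorem sum_card_comm {α β : Type*} [Fintype α] (s : Finset β) (p : α → β → Prop)
    [∀ a v, Decidable (p a v)] :
    ∑ v ∈ s, (Finset.univ.filter fun a : α => p a v).card =
      ∑ a : α, (s.filter fun v => p a v).card := by
  simp only [Finset.card_filter]
  exact Finset.sum_comm

theorem sum_gapArcs {n : ℕ} (σ : Equiv.Perm (Fin n)) :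
    ∑ v ∈ Finset.range n, gapArcs σ v = ∑ a : Fin n, ((σ a : ℕ) - a) := by
  unfold gapArcs
  rw [sum_card_comm]
  refine Finset.sum_congr rfl fun a _ => ?_
  rw [← Nat.card_Ioc]
  congr 1
  ext v
  have := (σ a).2
  simp
  omega

theorem card_forward_eq_card_backward {n : ℕ} (σ : Equiv.Perm (Fin n)) (x : Fin n) :
    (Finset.univ.filter fun y => y ≤ x ∧ x < σ y).card =
      (Finset.univ.filter fun y => σ y ≤ x ∧ x < y).card := by
  have h1 : (Finset.univ.filter fun y => y ≤ x).card =
      (Finset.univ.filter fun y => σ y ≤ x).card :=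
    (Finset.card_equiv σ (by simp)).symm
  have h2 := Finset.card_filter_add_card_filter_not
    (s := Finset.univ.filter fun y => y ≤ x) (fun y => σ y ≤ x)
  have h3 := Finset.card_filter_add_card_filter_not
    (s := Finset.univ.filter fun y => σ y ≤ x) (fun y => y ≤ x)
  simp only [Finset.filter_filter, not_le] at h2 h3
  have h4 : (Finset.univ.filter fun y => σ y ≤ x ∧ y ≤ x) =
    Finset.univ.filter fun y => y ≤ x ∧ σ y ≤ x := by simp only [and_comm]
  rw [h4] at h3
  omega

theorem PreservesArcs.invP_eq {n : ℕ} {σ : Equiv.Perm (Fin n)} (h : PreservesArcs σ) :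
    invP σ = ∑ v ∈ Finset.range n, (gapArcs σ v + vertexArcs σ v) := by
  have hset : (Finset.univ.filter fun p : Fin n × Fin n => p.1 < p.2 ∧ σ p.2 < σ p.1) =
      (Finset.univ.filter fun p : Fin n × Fin n => p.1 < p.2 ∧ p.2 < σ p.1) ∪
      Finset.univ.filter fun p : Fin n × Fin n => σ p.2 ≤ p.1 ∧ p.1 < p.2 := by
    ext ⟨x, y⟩
    simp only [Finset.mem_union, Finset.mem_filter, Finset.mem_univ, true_and]
    constructor
    · rintro ⟨hxy, hs⟩
      by_cases hyx : σ y ≤ x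
      · exact .inr ⟨hyx, hxy⟩
      · refine .inl ⟨hxy, ?_⟩
        exact (mem_of_sameCycle (S := Set.Ioo x (σ x)) (fun w hw => h.1 x w hw.1 hw.2)
          ⟨not_le.1 hyx, hs⟩ (sameCycle_apply σ y).symm).2
    · rintro (⟨h1, h2⟩ | ⟨h1, h2⟩)
      · exact ⟨h1, (h.1 x y h1 h2).2⟩
      · exact ⟨h2, lt_of_le_of_ne (h.2 x y h1 h2).1 fun he => h2.ne' (σ.injective he)⟩
  rw [invP, hset, Finset.card_union_of_disjoint, add_comm, Finset.sum_add_distrib]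
  · congr 1
    · rw [sum_gapArcs, Finset.card_filter, Fintype.sum_prod_type]
      simp only [← Finset.card_filter, ← card_forward_eq_card_backward]
      rw [sum_card_comm]
      refine Finset.sum_congr rfl fun a _ => ?_
      rw [← Fin.card_Ico]
      congr 1
      ext v
      simp
    · rw [Finset.card_filter, Fintype.sum_prod_type_right, ← Fin.sum_univ_eq_sum_range]
      simp only [← Finset.card_filter]
      rfl
  · rw [Finset.disjoint_filter]
    rintro ⟨x, y⟩ - ⟨h1, h2⟩ ⟨h3, -⟩
    exact absurd (h.1 x y h1 h2).1 (not_lt.2 h3)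

theorem countE_add_countN {m : ℕ} (w : Fin m → Bool) {k : ℕ} (hk : k ≤ m) :
    countE w k + countN w k = k := by
  have h := Finset.card_filter_add_card_filter_not
    (s := Finset.univ.filter fun t : Fin m => (t : ℕ) < k) (fun t => w t = false)
  simp only [Finset.filter_filter, Bool.not_eq_false] at h
  rw [countE, countN, h]
  exact (Fin.card_filter_val_lt).trans (min_eq_right hk)

theorem countE_mono {m : ℕ} (w : Fin m → Bool) : Monotone (countE w) := fun _ _ h =>
  Finset.card_le_card fun t ht => by
    simp only [Finset.mem_filter, Finset.mem_univ, true_and] at ht ⊢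
    exact ⟨ht.1.trans_le h, ht.2⟩

theorem countN_mono {m : ℕ} (w : Fin m → Bool) : Monotone (countN w) := fun _ _ h =>
  Finset.card_le_card fun t ht => by
    simp only [Finset.mem_filter, Finset.mem_univ, true_and] at ht ⊢
    exact ⟨ht.1.trans_le h, ht.2⟩

theorem countE_of_le {m : ℕ} (w : Fin m → Bool) {k : ℕ} (hk : m ≤ k) :
    countE w k = countE w m := by
  unfold countE
  congr 1
  ext t
  simp [t.2.trans_le hk]

theorem countN_of_le {m : ℕ} (w : Fin m → Bool) {k : ℕ} (hk : m ≤ k) :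
    countN w k = countN w m := by
  unfold countN
  congr 1
  ext t
  simp [t.2.trans_le hk]

theorem countE_zero {m : ℕ} (w : Fin m → Bool) : countE w 0 = 0 := by simp [countE]

theorem countE_succ {m : ℕ} (w : Fin m → Bool) (t : Fin m) :
    countE w (t + 1) = countE w t + if w t = false then 1 else 0 := by
  have h : (Finset.univ.filter fun s : Fin m => (s : ℕ) < t + 1 ∧ w s = false) =
      (Finset.univ.filter fun s : Fin m => (s : ℕ) < t ∧ w s = false) ∪
        Finset.univ.filter (fun s : Fin m => s = t ∧ w t = false) := by
    ext s
    simp only [Finset.mem_union, Finset.mem_filter, Finset.mem_univ, true_and]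
    constructor
    · rintro ⟨h1, h2⟩
      rcases (Nat.lt_succ_iff.1 h1).lt_or_eq with h | h
      · exact .inl ⟨h, h2⟩
      · obtain rfl := Fin.ext h
        exact .inr ⟨rfl, h2⟩
    · rintro (⟨h1, h2⟩ | ⟨rfl, h2⟩)
      · exact ⟨by omega, h2⟩
      · exact ⟨by omega, h2⟩
  rw [countE, h, Finset.card_union_of_disjoint]
  · congr 1
    exact card_filter_eq_and _ _
  · rw [Finset.disjoint_filter]
    rintro s - ⟨h1, -⟩ ⟨rfl, -⟩
    simp at h1

theorem isDyckA_iff {n : ℕ} (w : Fin (2 * n) → Bool) :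
    IsDyckA n w ↔ countE w (2 * n) = n ∧ ∀ k ≤ 2 * n, 2 * countE w k ≤ k := by
  have hn := countE_add_countN w le_rfl
  constructor
  · rintro ⟨h1, h2⟩
    refine ⟨by omega, fun k hk => ?_⟩
    have := countE_add_countN w hk
    have := h2 k
    omega
  · rintro ⟨h1, h2⟩
    refine ⟨by omega, fun k => ?_⟩
    rcases le_total k (2 * n) with hk | hk
    · have := countE_add_countN w hk
      have := h2 k hk
      omega
    · rw [countE_of_le w hk, countN_of_le w hk]
      omega

theorem cellBelow_iff {n : ℕ} {w : Fin (2 * n) → Bool} (hw : IsDyckA n w) {i j : ℕ}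
    (hij : i < j) : CellBelow w i j ↔ i + j ≤ 2 * n ∧ countE w (i + j - 1) < i := by
  constructor
  · rintro ⟨k, hk1, hk2⟩
    have hN : countN w k ≤ n := by
      rcases le_total k (2 * n) with hk | hk
      · exact (countN_mono w hk).trans hw.1.le
      · rw [countN_of_le w hk, hw.1]
    refine ⟨by omega, ?_⟩
    rcases le_total k (i + j - 1) with hk | hk
    · have := countN_mono w hk
      have := countE_add_countN w (k := i + j - 1) (by omega)
      omega
    · have := countE_mono w hk
      omega
  · rintro ⟨h1, h2⟩
    have := countE_add_countN w (k := i + j - 1) (by omega)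
    exact ⟨i + j - 1, h2, by omega⟩

theorem IsDyckA.areaA_eq {n : ℕ} {w : Fin (2 * n) → Bool} (hw : IsDyckA n w) :
    areaA w = ∑ t ∈ Finset.range (2 * n), (t / 2 - countE w t) := by
  have hset : {p : ℕ × ℕ | 1 ≤ p.1 ∧ p.1 < p.2 ∧ CellBelow w p.1 p.2} =
      ((Finset.range (2 * n)).sigma fun t => Finset.Ioc (countE w t) (t / 2)).image
        fun q : (_ : ℕ) × ℕ => (q.2, q.1 + 1 - q.2) := by
    ext ⟨i, j⟩
    simp only [Set.mem_ofPred_eq, Finset.coe_image, Set.mem_image, Finset.mem_coe,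
      Finset.mem_sigma, Finset.mem_range, Finset.mem_Ioc, Prod.mk.injEq, Sigma.exists]
    constructor
    · rintro ⟨hi, hij, hc⟩
      rw [cellBelow_iff hw hij] at hc
      exact ⟨i + j - 1, i, ⟨by omega, hc.2, by omega⟩, rfl, by omega⟩
    · rintro ⟨t, i', ⟨ht, h1, h2⟩, rfl, rfl⟩
      refine ⟨by omega, by omega, (cellBelow_iff hw (by omega)).2 ⟨by omega, ?_⟩⟩
      rwa [show i' + (t + 1 - i') - 1 = t by omega]
  rw [areaA, hset, Set.ncard_coe_finset, Finset.card_image_of_injOn]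
  · simp
  · rintro ⟨t, i⟩ h ⟨t', i'⟩ h' he
    simp only [Finset.coe_sigma, Set.mem_sigma_iff, Finset.mem_coe, Finset.mem_range,
      Finset.mem_Ioc, Prod.mk.injEq] at h h' he
    obtain ⟨rfl, he⟩ := he
    obtain rfl : t = t' := by omega
    rfl

/-- The lattice path of a permutation `σ`: step `2 x` is north iff `x ≤ σ⁻¹ x`, and step
`2 x + 1` is north iff `x < σ x`. -/
def pathOfPerm {n : ℕ} (σ : Equiv.Perm (Fin n)) (t : Fin (2 * n)) : Bool :=
  let x : Fin n := ⟨t / 2, by omega⟩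
  if (t : ℕ) % 2 = 0 then decide (x ≤ σ⁻¹ x) else decide (x < σ x)

/-- The even step `2 x` of a path of length `2 n`. -/
def evenStep {n : ℕ} (x : Fin n) : Fin (2 * n) := ⟨2 * x, by omega⟩

/-- The odd step `2 x + 1` of a path of length `2 n`. -/
def oddStep {n : ℕ} (x : Fin n) : Fin (2 * n) := ⟨2 * x + 1, by omega⟩

theorem pathOfPerm_evenStep {n : ℕ} (σ : Equiv.Perm (Fin n)) (x : Fin n) :
    pathOfPerm σ (evenStep x) = decide (x ≤ σ⁻¹ x) := by
  have h : (⟨((evenStep x : Fin (2 * n)) : ℕ) / 2, by omega⟩ : Fin n) = x :=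
    Fin.ext (by simp [evenStep])
  simp only [pathOfPerm, h]
  simp [evenStep]

theorem pathOfPerm_oddStep {n : ℕ} (σ : Equiv.Perm (Fin n)) (x : Fin n) :
    pathOfPerm σ (oddStep x) = decide (x < σ x) := by
  have h : (⟨((oddStep x : Fin (2 * n)) : ℕ) / 2, by omega⟩ : Fin n) = x :=
    Fin.ext (by simp only [oddStep]; omega)
  simp only [pathOfPerm, h]
  simp [oddStep]

theorem eq_pathOfPerm_iff {n : ℕ} (w : Fin (2 * n) → Bool) (σ : Equiv.Perm (Fin n)) :
    w = pathOfPerm σ ↔ ∀ x, (w (evenStep x) = true ↔ x ≤ σ⁻¹ x) ∧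
      (w (oddStep x) = true ↔ x < σ x) := by
  constructor
  · rintro rfl x
    simp only [pathOfPerm_evenStep, pathOfPerm_oddStep, decide_eq_true_eq, and_self]
  · intro h
    funext t
    have hx : (t : ℕ) / 2 < n := by omega
    rcases Nat.mod_two_eq_zero_or_one t with ht | ht
    · have he : t = evenStep ⟨(t : ℕ) / 2, hx⟩ := Fin.ext (by simp only [evenStep]; omega)
      rw [he, pathOfPerm_evenStep, Bool.eq_iff_iff, (h _).1, decide_eq_true_iff]
    · have he : t = oddStep ⟨(t : ℕ) / 2, hx⟩ := Fin.ext (by simp only [oddStep]; omega)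
      rw [he, pathOfPerm_oddStep, Bool.eq_iff_iff, (h _).2, decide_eq_true_iff]

theorem countE_pathOfPerm_odd_of_even {n : ℕ} (σ : Equiv.Perm (Fin n)) (v : Fin n)
    (h : countE (pathOfPerm σ) (2 * v) + gapArcs σ v = v) :
    countE (pathOfPerm σ) (2 * v + 1) + vertexArcs σ v = v := by
  have h1 := countE_succ (pathOfPerm σ) (evenStep v)
  rw [pathOfPerm_evenStep] at h1
  have h2 := gapArcs_eq σ v
  simp only [evenStep, decide_eq_false_iff_not, not_le] at h1
  omega

theorem countE_pathOfPerm_even {n : ℕ} (σ : Equiv.Perm (Fin n)) {v : ℕ} (hv : v ≤ n) :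
    countE (pathOfPerm σ) (2 * v) + gapArcs σ v = v := by
  induction v with
  | zero => simp [countE_zero, gapArcs]
  | succ v ih =>
    have h := countE_pathOfPerm_odd_of_even σ ⟨v, hv⟩ (ih (by omega))
    have h1 := countE_succ (pathOfPerm σ) (oddStep ⟨v, hv⟩)
    rw [pathOfPerm_oddStep] at h1
    have h2 := gapArcs_succ σ ⟨v, hv⟩
    simp only [oddStep, decide_eq_false_iff_not] at h h1 h2
    rw [show 2 * (v + 1) = 2 * v + 1 + 1 by ring]
    split_ifs at h1 h2 <;> omega

theorem countE_pathOfPerm_odd {n : ℕ} (σ : Equiv.Perm (Fin n)) {v : ℕ} (hv : v < n) :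
    countE (pathOfPerm σ) (2 * v + 1) + vertexArcs σ v = v :=
  countE_pathOfPerm_odd_of_even σ ⟨v, hv⟩ (countE_pathOfPerm_even σ hv.le)

theorem isDyckA_pathOfPerm {n : ℕ} (σ : Equiv.Perm (Fin n)) : IsDyckA n (pathOfPerm σ) := by
  rw [isDyckA_iff]
  constructor
  · have h := countE_pathOfPerm_even σ le_rfl
    have h0 : gapArcs σ n = 0 := by simp [gapArcs, Finset.filter_eq_empty_iff]
    omega
  · intro k hk
    rcases Nat.even_or_odd' k with ⟨v, rfl | rfl⟩
    · have := countE_pathOfPerm_even σ (v := v) (by omega)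
      omega
    · have := countE_pathOfPerm_odd σ (v := v) (by omega)
      omega

theorem sum_range_two_mul (f : ℕ → ℕ) (n : ℕ) :
    ∑ t ∈ Finset.range (2 * n), f t = ∑ v ∈ Finset.range n, (f (2 * v) + f (2 * v + 1)) := by
  induction n with
  | zero => simp
  | succ n ih => rw [Finset.sum_range_succ, ← ih, mul_add, Finset.sum_range_succ,
      Finset.sum_range_succ, add_assoc]

theorem areaA_pathOfPerm {n : ℕ} (σ : Equiv.Perm (Fin n)) :
    areaA (pathOfPerm σ) = ∑ v ∈ Finset.range n, (gapArcs σ v + vertexArcs σ v) := by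
  rw [(isDyckA_pathOfPerm σ).areaA_eq, sum_range_two_mul]
  refine Finset.sum_congr rfl fun v hv => ?_
  rw [Finset.mem_range] at hv
  have := countE_pathOfPerm_even σ hv.le
  have := countE_pathOfPerm_odd σ hv
  omega

section Injectivity

variable {n : ℕ} {σ τ : Equiv.Perm (Fin n)}

theorem PreservesArcs.not_lt_of_forward (hσ : PreservesArcs σ) (hτ : PreservesArcs τ)
    (ho : ∀ x, x < σ x ↔ x < τ x) (hc : ∀ x, x ≤ σ⁻¹ x ↔ x ≤ τ⁻¹ x) (x : Fin n)
    (hx : x < σ x) : ¬ σ x < τ x := by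
  intro hlt
  induction hm : (σ x : ℕ) using Nat.strong_induction_on generalizing x with
  | _ m ih =>
    obtain ⟨z, hz⟩ := τ.surjective (σ x)
    have hzlt : z < τ z := by
      have := hc (σ x)
      rw [inv_apply_apply, ← hz, inv_apply_apply, hz] at this
      rw [hz]
      exact not_le.1 fun h => absurd (this.2 h) (not_le.2 hx)
    have hxz : x < z := (mem_of_sameCycle (S := Set.Ioo x (τ x)) (fun w hw => hτ.1 x w hw.1 hw.2)
      (hz ▸ ⟨hx, hlt⟩) (sameCycle_apply τ z).symm).1
    have hσz := (hσ.1 x z hxz (hz ▸ hzlt)).2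
    exact ih (σ z) (hm ▸ hσz) z ((ho z).2 hzlt) (hz ▸ hσz) rfl

theorem PreservesArcs.not_lt_of_backward (hσ : PreservesArcs σ) (hτ : PreservesArcs τ)
    (ho : ∀ x, x < σ x ↔ x < τ x) (hc : ∀ x, x ≤ σ⁻¹ x ↔ x ≤ τ⁻¹ x) (x : Fin n)
    (hx : τ x ≤ x) : ¬ σ x < τ x := by
  intro hlt
  induction hm : (x : ℕ) using Nat.strong_induction_on generalizing x with
  | _ m ih =>
    obtain ⟨z, hz⟩ := σ.surjective (τ x)
    have hzle : σ z ≤ z := by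
      have := hc (τ x)
      rw [inv_apply_apply, ← hz, inv_apply_apply, hz] at this
      exact hz ▸ this.2 hx
    have hσx := hlt.le.trans hx
    have hzx : z ≤ x := (mem_of_sameCycle (S := Set.Icc (σ x) x) (fun w hw => by
      rcases hw.2.eq_or_lt with rfl | h
      · exact ⟨le_rfl, hσx⟩
      · exact hσ.2 w x hw.1 h) (hz ▸ ⟨hlt.le, hx⟩) (sameCycle_apply σ z).symm).2
    have hne : z ≠ x := fun h => hlt.ne (h ▸ hz)
    have hzx' := lt_of_le_of_ne hzx hne
    have hτz := (hτ.2 z x (hz ▸ hzle) hzx').1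
    exact ih z (hm ▸ hzx') z (not_lt.1 fun h => absurd ((ho z).2 h) (not_lt.2 hzle))
      (hz ▸ lt_of_le_of_ne hτz fun h => hne (τ.injective h).symm) rfl

theorem PreservesArcs.eq_of_pathOfPerm_eq (hσ : PreservesArcs σ) (hτ : PreservesArcs τ)
    (h : pathOfPerm σ = pathOfPerm τ) : σ = τ := by
  have h1 := (eq_pathOfPerm_iff _ τ).1 h
  have h2 := (eq_pathOfPerm_iff _ σ).1 rfl
  have ho : ∀ x, x < σ x ↔ x < τ x := fun x => (h2 x).2.symm.trans (h1 x).2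
  have hc : ∀ x, x ≤ σ⁻¹ x ↔ x ≤ τ⁻¹ x := fun x => (h2 x).1.symm.trans (h1 x).1
  ext x : 1
  by_cases hx : x < σ x
  · exact le_antisymm
      (not_lt.1 (hτ.not_lt_of_forward hσ (fun x => (ho x).symm) (fun x => (hc x).symm) x
        ((ho x).1 hx)))
      (not_lt.1 (hσ.not_lt_of_forward hτ ho hc x hx))
  · exact le_antisymm
      (not_lt.1 (hτ.not_lt_of_backward hσ (fun x => (ho x).symm) (fun x => (hc x).symm) x
        (not_lt.1 hx)))
      (not_lt.1 (hσ.not_lt_of_backward hτ ho hc x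
        (not_lt.1 fun h => hx ((ho x).2 h))))

end Injectivity

/-- The height of a path after `k` steps: north steps minus east steps. -/
def height {m : ℕ} (w : Fin m → Bool) (k : ℕ) : ℤ := k - 2 * countE w k

theorem height_succ {m : ℕ} (w : Fin m → Bool) (t : Fin m) :
    height w (t + 1) = height w t + if w t = true then 1 else -1 := by
  unfold height
  rw [countE_succ]
  cases w t <;> push_cast <;> simp <;> ring

/-- Step `s` is a north step whose matching east step is `t`: the path returns to its height
before step `s` for the first time after step `t`. -/
def IsMatch {m : ℕ} (w : Fin m → Bool) (s t : ℕ) : Prop :=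
  s < t ∧ height w (t + 1) = height w s ∧ ∀ u, s < u → u ≤ t → height w s < height w u

namespace IsMatch

variable {m : ℕ} {w : Fin m → Bool} {s t s' t' : ℕ}

theorem height_lt_succ (h : IsMatch w s t) : height w s < height w (s + 1) :=
  h.2.2 _ (Nat.lt_succ_self s) h.1

theorem height_succ_lt (h : IsMatch w s t) : height w (t + 1) < height w t :=
  h.2.1 ▸ h.2.2 t h.1 le_rfl

theorem apply_left (h : IsMatch w s t) (hs : s < m) : w ⟨s, hs⟩ = true := by
  have h1 := h.height_lt_succ
  have h2 := height_succ w ⟨s, hs⟩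
  by_contra hc
  rw [if_neg hc] at h2
  simp only at h2
  omega

theorem apply_right (h : IsMatch w s t) (ht : t < m) : w ⟨t, ht⟩ ≠ true := by
  intro hc
  have h1 := h.height_succ_lt
  have h2 := height_succ w ⟨t, ht⟩
  rw [if_pos hc] at h2
  simp only at h2
  omega

theorem left_unique (h : IsMatch w s t) (h' : IsMatch w s' t) : s = s' := by
  rcases lt_trichotomy s s' with hlt | he | hlt
  · have := h.2.2 s' hlt h'.1.le
    exact absurd (h'.2.1.symm.trans h.2.1) this.ne'
  · exact he
  · have := h'.2.2 s hlt h.1.le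
    exact absurd (h.2.1.symm.trans h'.2.1) this.ne'

theorem right_lt_right (h : IsMatch w s t) (h' : IsMatch w s' t') (hs : s < s') (ht : s' < t) :
    t' < t := by
  have h1 := h.2.2 s' hs ht.le
  by_contra hc
  rcases (not_lt.1 hc).eq_or_lt with rfl | hlt
  · exact absurd (h'.2.1.symm.trans h.2.1) h1.ne'
  · have := h'.2.2 (t + 1) (by omega) hlt
    rw [h.2.1] at this
    omega

theorem parity (h : IsMatch w s t) : (s + t) % 2 = 1 := by
  have := h.2.1
  unfold height at this
  omega

end IsMatch

theorem IsDyckA.height_nonneg {n : ℕ} {w : Fin (2 * n) → Bool} (hw : IsDyckA n w) {k : ℕ}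
    (hk : k ≤ 2 * n) : 0 ≤ height w k := by
  have := ((isDyckA_iff w).1 hw).2 k hk
  unfold height
  omega

theorem IsDyckA.height_end {n : ℕ} {w : Fin (2 * n) → Bool} (hw : IsDyckA n w) :
    height w (2 * n) = 0 := by
  have := ((isDyckA_iff w).1 hw).1
  unfold height
  omega

theorem IsDyckA.exists_match_right {n : ℕ} {w : Fin (2 * n) → Bool} (hw : IsDyckA n w)
    (s : Fin (2 * n)) (hs : w s = true) : ∃ t : Fin (2 * n), IsMatch w s t := by
  have hex : ∃ u, (s : ℕ) < u ∧ u ≤ 2 * n ∧ height w u ≤ height w s :=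
    ⟨2 * n, s.2, le_rfl, by rw [hw.height_end]; exact hw.height_nonneg s.2.le⟩
  obtain ⟨h1, h2, h3⟩ := Nat.find_spec hex
  have hmin := fun k hk => Nat.find_min hex (m := k) hk
  generalize Nat.find hex = u at h1 h2 h3 hmin
  have hgt : ∀ v, (s : ℕ) < v → v < u → height w s < height w v := fun v hv1 hv2 => by
    by_contra hc
    exact hmin v hv2 ⟨hv1, by omega, not_lt.1 hc⟩
  have hs1 := height_succ w s
  rw [if_pos hs] at hs1
  obtain ⟨t, rfl⟩ : ∃ t, u = t + 1 := ⟨u - 1, by omega⟩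
  have hst : (s : ℕ) < t := by
    rcases (Nat.lt_succ_iff.1 h1).lt_or_eq with h | h
    · exact h
    · rw [← h] at h3
      omega
  have ht := height_succ w ⟨t, by omega⟩
  have hgt' := hgt t hst (by omega)
  refine ⟨⟨t, by omega⟩, hst, ?_, fun v hv1 hv2 => hgt v hv1 (Nat.lt_succ_of_le hv2)⟩
  simp only at ht ⊢
  split_ifs at ht <;> omega

theorem IsDyckA.exists_match_left {n : ℕ} {w : Fin (2 * n) → Bool} (hw : IsDyckA n w)
    (t : Fin (2 * n)) (ht : w t ≠ true) : ∃ s : Fin (2 * n), IsMatch w s t := by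
  have h0 : height w 0 ≤ height w (t + 1) := by
    refine le_trans ?_ (hw.height_nonneg t.2)
    simp [height]
  have hspec := Nat.findGreatest_spec (P := fun u => height w u ≤ height w (t + 1))
    (Nat.zero_le t) h0
  have hle := Nat.findGreatest_le (P := fun u => height w u ≤ height w (t + 1)) (t : ℕ)
  have hmax : ∀ k, _ → k ≤ (t : ℕ) → ¬ height w k ≤ height w (t + 1) := fun k h1 h2 =>
    Nat.findGreatest_is_greatest (P := fun u => height w u ≤ height w (t + 1)) h1 h2
  generalize Nat.findGreatest (fun u => height w u ≤ height w (t + 1)) t = s at hspec hle hmax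
  have ht1 := height_succ w t
  rw [if_neg ht] at ht1
  have hst : s < t := by
    rcases hle.lt_or_eq with h | h
    · exact h
    · rw [h] at hspec
      omega
  have hs := height_succ w ⟨s, by omega⟩
  have hs' := hmax (s + 1) (by omega) hst
  have he : height w (t + 1) = height w s := by
    simp only at hs
    split_ifs at hs <;> omega
  exact ⟨⟨s, by omega⟩, hst, he, fun u hu1 hu2 => he ▸ not_le.1 (hmax u hu1 hu2)⟩

/-- The odd step `2 x + 1` is matched with the even step `2 y`, in either order. -/
def OddEvenMatch {n : ℕ} (w : Fin (2 * n) → Bool) (x y : Fin n) : Prop :=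
  IsMatch w (2 * x + 1) (2 * y) ∨ IsMatch w (2 * y) (2 * x + 1)

theorem IsDyckA.exists_oddEvenMatch {n : ℕ} {w : Fin (2 * n) → Bool} (hw : IsDyckA n w)
    (x : Fin n) : ∃ y, OddEvenMatch w x y := by
  by_cases hx : w (oddStep x) = true
  · obtain ⟨t, ht⟩ := hw.exists_match_right _ hx
    have hp := ht.parity
    simp only [oddStep] at hp ht
    refine ⟨⟨t / 2, by omega⟩, .inl ?_⟩
    rwa [show 2 * ((t : ℕ) / 2) = t by omega]
  · obtain ⟨s, hs⟩ := hw.exists_match_left _ hx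
    have hp := hs.parity
    simp only [oddStep] at hp hs
    refine ⟨⟨s / 2, by omega⟩, .inr ?_⟩
    rwa [show 2 * ((s : ℕ) / 2) = s by omega]

theorem OddEvenMatch.left_unique {n : ℕ} {w : Fin (2 * n) → Bool} {x x' y : Fin n}
    (h : OddEvenMatch w x y) (h' : OddEvenMatch w x' y) : x = x' := by
  rcases h with h | h <;> rcases h' with h' | h'
  · have := h.left_unique h'
    omega
  · exact absurd h.height_succ_lt h'.height_lt_succ.asymm
  · exact absurd h.height_lt_succ h'.height_succ_lt.asymm
  · rcases lt_trichotomy x x' with hlt | he | hlt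
    · have := h'.2.2 (2 * x + 1 + 1) (by have := h.1; omega) (by omega)
      exact absurd h.2.1 this.ne'
    · exact he
    · have := h.2.2 (2 * x' + 1 + 1) (by have := h'.1; omega) (by omega)
      exact absurd h'.2.1 this.ne'

theorem IsDyckA.exists_perm {n : ℕ} {w : Fin (2 * n) → Bool} (hw : IsDyckA n w) :
    ∃ σ : Equiv.Perm (Fin n), PreservesArcs σ ∧ pathOfPerm σ = w := by
  choose f hf using hw.exists_oddEvenMatch
  have hinj : Function.Injective f := fun x x' he => (hf x).left_unique (he ▸ hf x')
  obtain ⟨σ, rfl⟩ : ∃ σ : Equiv.Perm (Fin n), ⇑σ = f :=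
    ⟨Equiv.ofBijective f (Finite.injective_iff_bijective.1 hinj), rfl⟩
  refine ⟨σ, ⟨fun x y hxy hy => ?_, fun x y hyx hxy => ?_⟩, ?_⟩
  · rcases hf x with hx | hx
    · rcases hf y with hy' | hy'
      · have := hx.right_lt_right hy' (by omega) (by omega)
        have := hy'.1
        omega
      · have := hy'.1
        have := fun h1 h2 => hy'.right_lt_right hx h1 h2
        omega
    · have := hx.1
      omega
  · rcases hf y with hy | hy
    · have := hy.1
      omega
    · rcases hf x with hx | hx
      · have := hy.right_lt_right hx (by omega) (by omega)
        have := hx.1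
        omega
      · have := hx.1
        have := fun h1 h2 => hx.right_lt_right hy h1 h2
        omega
  · refine ((eq_pathOfPerm_iff w σ).2 fun x => ⟨?_, ?_⟩).symm
    · obtain ⟨z, rfl⟩ := σ.surjective x
      rw [inv_apply_apply]
      rcases hf z with hz | hz
      · have h1 := hz.apply_right (by omega)
        have h2 := hz.1
        exact iff_of_false h1 (by omega)
      · have h1 := hz.apply_left (by omega)
        have h2 := hz.1
        exact iff_of_true h1 (by omega)
    · rcases hf x with hx | hx
      · have h1 := hx.apply_left (by omega)
        have h2 := hx.1
        exact iff_of_true h1 (by omega)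
      · have h1 := hx.apply_right (by omega)
        have h2 := hx.1
        exact iff_of_false h1 (by omega)

/-- For every `n ≥ 1` and every `k`, Dyck paths of length `n` with area `k` are
equinumerous with non-crossing permutations of `{1,…,n}` with `k` inversions. -/
theorem area_eq_inv_NC (n : ℕ) (hn : 1 ≤ n) (k : ℕ) :
    {w : Fin (2 * n) → Bool | IsDyckA n w ∧ areaA w = k}.ncard =
      {σ : Equiv.Perm (Fin n) | IsNC σ ∧ invP σ = k}.ncard := by
  rw [← Set.InjOn.ncard_image (f := pathOfPerm)
    (s := {σ : Equiv.Perm (Fin n) | IsNC σ ∧ invP σ = k})]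
  · congr 1
    ext w
    constructor
    · rintro ⟨hw, hk⟩
      obtain ⟨σ, hσ, rfl⟩ := hw.exists_perm
      refine ⟨σ, ⟨isNC_iff_preservesArcs.2 hσ, ?_⟩, rfl⟩
      rw [hσ.invP_eq, ← areaA_pathOfPerm, hk]
    · rintro ⟨σ, ⟨hσ, hk⟩, rfl⟩
      refine ⟨isDyckA_pathOfPerm σ, ?_⟩
      rw [areaA_pathOfPerm, ← hσ.preservesArcs.invP_eq, hk]
  · rintro σ ⟨hσ, -⟩ τ ⟨hτ, -⟩ h
    exact hσ.preservesArcs.eq_of_pathOfPerm_eq hτ.preservesArcs h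

end Stmt
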